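/- arXiv:2605.16553 — 2 statements merged into one kernel-verified Lean document; each statement's English description precedes it below -/
import Mathlib

section
/- Let t, A, y be rational numbers satisfying y⁴ - y³ - y² + y - t = 0 and (1 - 4A)·y² - A·y + (A - 1) = 0. Then (256t² + 107t - 32)·(A⁴ - A³) + (96t² + 36t)·A² - (16t² + 4t)·A + t² = 0. -/
/-- Elimination identity: if rationals `t, A, y` satisfy
`y⁴ - y³ - y² + y - t = 0` and `(1 - 4A)·y² - A·y + (A - 1) = 0`, then the
eliminant polynomial vanishes:
`(256t² + 107t - 32)·(A⁴ - A³) + (96t² + 36t)·A² - (16t² + 4t)·A + t² = 0`. -/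
theorem stmt6 (t A y : ℚ)
    (h1 : y ^ 4 - y ^ 3 - y ^ 2 + y - t = 0)
    (h2 : (1 - 4 * A) * y ^ 2 - A * y + (A - 1) = 0) :
    (256 * t ^ 2 + 107 * t - 32) * (A ^ 4 - A ^ 3) +
      (96 * t ^ 2 + 36 * t) * A ^ 2 - (16 * t ^ 2 + 4 * t) * A + t ^ 2 = 0 := by
  have hD : 1 - y - 4 * y ^ 2 ≠ 0 := by
    intro hD
    have hN : y ^ 2 = 1 := by linear_combination h2 - A * hD
    have hy : y = -3 := by linear_combination -hD - 4 * hN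
    norm_num [hy] at hN
  obtain rfl : A = (1 - y ^ 2) / (1 - y - 4 * y ^ 2) := by
    rw [eq_div_iff hD]
    linear_combination h2
  obtain rfl : t = y ^ 4 - y ^ 3 - y ^ 2 + y := by linear_combination -h1
  clear h1 h2
  generalize hd : 1 - y - 4 * y ^ 2 = D at hD ⊢
  field_simp
  subst hd
  ring
end

section
/- Define b : ℕ → ℚ by b(n) = ∑_{k=0}^{⌊n/2⌋} C(2n-2k-1, n-2k)·C(n+k-1, k), where C denotes the binomial coefficient. Then for every natural number n with 3 ≤ n ≤ 1000, the identity 16·(n-1)·n·(2n-1)·(51n² - 162n + 127)·b(n) = (n-1)·(5457n⁴ - 22791n³ + 32144n² - 17536n + 3072)·b(n-1) + 8·(2n-3)·(4n-7)·(4n-5)·(51n² - 60n + 16)·b(n-2) holds. -/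
/-- P. Bala's binomial-sum closed form for OEIS A348410:
`b(n) = ∑_{k=0}^{⌊n/2⌋} C(2n-2k-1, n-2k) · C(n+k-1, k)`. -/
noncomputable def balaSum (n : ℕ) : ℚ :=
  ∑ k ∈ Finset.range (n / 2 + 1),
    ((Nat.choose (2 * n - 2 * k - 1) (n - 2 * k) : ℚ) *
      (Nat.choose (n + k - 1) k : ℚ))

open Nat in
/-- A hypergeometric kernel common to the summands of `balaSum n`, `balaSum (n - 1)` and
`balaSum (n - 2)` at `n = m + 5`: each of them is a polynomial multiple of it. -/
noncomputable def balaKernel (m k : ℕ) : ℚ :=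
  ((m + (m + 5 - 2 * k))! * (m + k + 2)! : ℚ) /
    ((m + 5 - 2 * k)! * k ! * ((m + 4)! : ℚ) ^ 2)

/-- The polynomial part of the Zeilberger certificate of the recurrence. -/
def balaCert (n k : ℚ) : ℚ :=
  (-8772 * n ^ 8 + 80802 * n ^ 7 - 320608 * n ^ 6 + 715072 * n ^ 5 - 979852 * n ^ 4
      + 843878 * n ^ 3 - 445112 * n ^ 2 + 130848 * n - 16256)
    + (4080 * n ^ 7 - 28770 * n ^ 6 + 79730 * n ^ 5 - 108434 * n ^ 4 + 73366 * n ^ 3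
      - 22068 * n ^ 2 + 2864 * n - 768) * k
    + (-1428 * n ^ 6 + 15960 * n ^ 5 - 53872 * n ^ 4 + 75672 * n ^ 3 - 42908 * n ^ 2
      + 4528 * n + 2048) * k ^ 2
    + (-3672 * n ^ 5 + 12072 * n ^ 4 - 7176 * n ^ 3 - 9352 * n ^ 2 + 8128 * n) * k ^ 3
    + (3264 * n ^ 4 - 13632 * n ^ 3 + 18496 * n ^ 2 - 8128 * n) * k ^ 4

lemma balaSum_eq_sum_range {n N : ℕ} (hN : n / 2 < N) (g : ℕ → ℚ)
    (hg : ∀ k, 2 * k ≤ n → ((2 * n - 2 * k - 1).choose (n - 2 * k) : ℚ) *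
      ((n + k - 1).choose k : ℚ) = g k)
    (hg_zero : ∀ k < N, n < 2 * k → g k = 0) :
    balaSum n = ∑ k ∈ Finset.range N, g k := by
  rw [balaSum]
  refine (Finset.sum_congr rfl fun k hk => hg k ?_).trans
    (Finset.sum_subset (Finset.range_mono hN) fun k hk hk' => ?_)
  · rw [Finset.mem_range] at hk
    omega
  · rw [Finset.mem_range] at hk hk'
    exact hg_zero k hk (by omega)

lemma balaSum_add_five (m : ℕ) :
    balaSum (m + 5) = ∑ k ∈ Finset.range ((m + 5) / 2 + 1),
      (2 * m - 2 * k + 9 : ℚ) * (2 * m - 2 * k + 8) * (2 * m - 2 * k + 7) *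
        (2 * m - 2 * k + 6) * (m + k + 4) * (m + k + 3) * balaKernel m k := by
  refine balaSum_eq_sum_range (Nat.lt_succ_self _) _ (fun k hk => ?_) fun k hk _ => by omega
  obtain ⟨r, hr⟩ := Nat.exists_eq_add_of_le hk
  have hrq : (m : ℚ) = 2 * k + r - 5 := by
    rw [eq_sub_iff_add_eq]; exact_mod_cast hr
  rw [balaKernel, show m + 5 - 2 * k = r by omega,
    show 2 * (m + 5) - 2 * k - 1 = r + (m + 4) by omega,
    show m + 5 + k - 1 = k + (m + 4) by omega, Nat.cast_add_choose, Nat.cast_add_choose,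
    show r + (m + 4) = m + r + 4 by omega, show k + (m + 4) = m + k + 2 + 2 by omega]
  simp only [Nat.factorial_succ (m + r + 3), Nat.factorial_succ (m + r + 2),
    Nat.factorial_succ (m + r + 1), Nat.factorial_succ (m + r),
    Nat.factorial_succ (m + k + 2 + 1), Nat.factorial_succ (m + k + 2)]
  push_cast
  field_simp
  rw [hrq]
  ring

lemma balaSum_add_four (m : ℕ) :
    balaSum (m + 4) = ∑ k ∈ Finset.range ((m + 5) / 2 + 1),
      (2 * m - 2 * k + 7 : ℚ) * (2 * m - 2 * k + 6) * (m + k + 3) * (m + 5 - 2 * k) *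
        (m + 4) ^ 2 * balaKernel m k := by
  refine balaSum_eq_sum_range (by omega) _ (fun k hk => ?_) fun k hk hk' => ?_
  · obtain ⟨r, hr⟩ := Nat.exists_eq_add_of_le hk
    have hrq : (m : ℚ) = 2 * k + r - 4 := by
      rw [eq_sub_iff_add_eq]; exact_mod_cast hr
    rw [balaKernel, show m + 5 - 2 * k = r + 1 by omega, show m + 4 - 2 * k = r by omega,
      show 2 * (m + 4) - 2 * k - 1 = r + (m + 3) by omega,
      show m + 4 + k - 1 = k + (m + 3) by omega, Nat.cast_add_choose, Nat.cast_add_choose,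
      show r + (m + 3) = m + (r + 1) + 2 by omega, show k + (m + 3) = m + k + 2 + 1 by omega]
    simp only [Nat.factorial_succ (m + (r + 1) + 1), Nat.factorial_succ (m + (r + 1)),
      Nat.factorial_succ (m + k + 2), Nat.factorial_succ r, Nat.factorial_succ (m + 3)]
    push_cast
    field_simp
    rw [hrq]
    ring
  · have h : (m + 5 : ℚ) = 2 * k := by
      exact_mod_cast (show m + 5 = 2 * k by omega)
    rw [h]
    ring

lemma balaSum_add_three (m : ℕ) :
    balaSum (m + 3) = ∑ k ∈ Finset.range ((m + 5) / 2 + 1),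
      (m + 5 - 2 * k : ℚ) * (m + 4 - 2 * k) * (m + 4) ^ 2 * (m + 3) ^ 2 * balaKernel m k := by
  refine balaSum_eq_sum_range (by omega) _ (fun k hk => ?_) fun k hk hk' => ?_
  · obtain ⟨r, hr⟩ := Nat.exists_eq_add_of_le hk
    have hrq : (m : ℚ) = 2 * k + r - 3 := by
      rw [eq_sub_iff_add_eq]; exact_mod_cast hr
    rw [balaKernel, show m + 5 - 2 * k = r + 2 by omega, show m + 3 - 2 * k = r by omega,
      show 2 * (m + 3) - 2 * k - 1 = r + (m + 2) by omega,
      show m + 3 + k - 1 = k + (m + 2) by omega, Nat.cast_add_choose, Nat.cast_add_choose,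
      show r + (m + 2) = m + (r + 2) by omega, show k + (m + 2) = m + k + 2 by omega]
    simp only [Nat.factorial_succ (r + 1), Nat.factorial_succ r, Nat.factorial_succ (m + 3),
      Nat.factorial_succ (m + 2)]
    push_cast
    field_simp
    rw [hrq]
    ring
  · obtain h | h : m + 5 = 2 * k ∨ m + 4 = 2 * k := by omega
    · have h' : (m + 5 : ℚ) = 2 * k := by exact_mod_cast h
      rw [h']
      ring
    · have h' : (m + 4 : ℚ) - 2 * k = 0 := by
        rw [sub_eq_zero]; exact_mod_cast h
      rw [h']
      ring

lemma balaKernel_succ (m k : ℕ) (hk : 2 * (k + 1) ≤ m + 5) :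
    (m + 5 - 2 * k : ℚ) * (m + 4 - 2 * k) * (m + k + 3) * balaKernel m k =
      (2 * m - 2 * k + 5) * (2 * m - 2 * k + 4) * (k + 1) * balaKernel m (k + 1) := by
  obtain ⟨r, hr⟩ := Nat.exists_eq_add_of_le hk
  have hrq : (m : ℚ) = 2 * (k + 1) + r - 5 := by
    rw [eq_sub_iff_add_eq]; exact_mod_cast hr
  rw [balaKernel, balaKernel, show m + 5 - 2 * k = r + 2 by omega,
    show m + 5 - 2 * (k + 1) = r by omega, show m + (r + 2) = m + r + 2 by omega,
    show m + (k + 1) + 2 = m + k + 2 + 1 by omega]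
  simp only [Nat.factorial_succ (r + 1), Nat.factorial_succ r, Nat.factorial_succ (m + r + 1),
    Nat.factorial_succ (m + r), Nat.factorial_succ (m + k + 2), Nat.factorial_succ k]
  push_cast
  field_simp
  rw [hrq]
  ring

/-- The `k`-th summand of the recurrence, `n = m + 5`, is this polynomial times `balaKernel m k`. -/
def balaRecPoly (n k : ℚ) : ℚ :=
  16 * (n - 1) * n * (2 * n - 1) * (51 * n ^ 2 - 162 * n + 127) *
      ((2 * n - 2 * k - 1) * (2 * n - 2 * k - 2) * (2 * n - 2 * k - 3) * (2 * n - 2 * k - 4) *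
        (n + k - 1) * (n + k - 2)) -
    (n - 1) * (5457 * n ^ 4 - 22791 * n ^ 3 + 32144 * n ^ 2 - 17536 * n + 3072) *
      ((2 * n - 2 * k - 3) * (2 * n - 2 * k - 4) * (n + k - 2) * (n - 2 * k) * (n - 1) ^ 2) -
    8 * (2 * n - 3) * (4 * n - 7) * (4 * n - 5) * (51 * n ^ 2 - 60 * n + 16) *
      ((n - 2 * k) * (n - 2 * k - 1) * (n - 1) ^ 2 * (n - 2) ^ 2)

lemma balaRecPoly_eq (n k : ℚ) :
    balaRecPoly n k = (n - 2 * k) * (n - 2 * k - 1) * (n + k - 2) * balaCert n (k + 1) -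
      (2 * n - 2 * k - 3) * (2 * n - 2 * k - 4) * k * balaCert n k := by
  unfold balaRecPoly balaCert
  ring

lemma sum_balaRecPoly_mul_balaKernel (m K : ℕ) (hK : 2 * K ≤ m + 5) :
    ∑ k ∈ Finset.range (K + 1), balaRecPoly (m + 5) k * balaKernel m k =
      (m + 5 - 2 * K : ℚ) * (m + 4 - 2 * K) * (m + K + 3) * balaCert (m + 5) (K + 1) *
        balaKernel m K := by
  induction K with
  | zero =>
    rw [zero_add, Finset.sum_range_one, balaRecPoly_eq]
    push_cast
    ring
  | succ K ih =>
    rw [Finset.sum_range_succ, ih (by omega), balaRecPoly_eq]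
    push_cast
    linear_combination balaCert (m + 5) (K + 1) * balaKernel_succ m K hK

lemma balaSum_recurrence (m : ℕ) (n : ℚ) (hn : n = m + 5) :
    16 * (n - 1) * n * (2 * n - 1) * (51 * n ^ 2 - 162 * n + 127) * balaSum (m + 5) =
      (n - 1) * (5457 * n ^ 4 - 22791 * n ^ 3 + 32144 * n ^ 2 - 17536 * n + 3072) *
          balaSum (m + 4) +
        8 * (2 * n - 3) * (4 * n - 7) * (4 * n - 5) * (51 * n ^ 2 - 60 * n + 16) *
          balaSum (m + 3) := by
  have h := sum_balaRecPoly_mul_balaKernel m ((m + 5) / 2) (by omega)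
  have h_top : (m + 5 - 2 * ((m + 5) / 2 : ℕ) : ℚ) * (m + 4 - 2 * ((m + 5) / 2 : ℕ)) = 0 := by
    rw [mul_eq_zero, sub_eq_zero, sub_eq_zero]
    obtain h | h : m + 5 = 2 * ((m + 5) / 2) ∨ m + 4 = 2 * ((m + 5) / 2) := by omega
    · exact Or.inl (by exact_mod_cast h)
    · exact Or.inr (by exact_mod_cast h)
  rw [h_top, zero_mul, zero_mul, zero_mul] at h
  rw [← sub_eq_zero, ← h, balaSum_add_five, balaSum_add_four, balaSum_add_three, ← sub_sub,
    Finset.mul_sum, Finset.mul_sum, Finset.mul_sum, ← Finset.sum_sub_distrib,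
    ← Finset.sum_sub_distrib]
  refine Finset.sum_congr rfl fun k _ => ?_
  rw [hn, balaRecPoly]
  ring

/-- Kotesovec's conjectured order-2 recurrence for A348410 holds for
`3 ≤ n ≤ 1000`. -/
theorem stmt11 :
    ∀ n : ℕ, 3 ≤ n → n ≤ 1000 →
      16 * ((n : ℚ) - 1) * (n : ℚ) * (2 * (n : ℚ) - 1) *
          (51 * (n : ℚ) ^ 2 - 162 * (n : ℚ) + 127) * balaSum n =
        ((n : ℚ) - 1) *
            (5457 * (n : ℚ) ^ 4 - 22791 * (n : ℚ) ^ 3 + 32144 * (n : ℚ) ^ 2 -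
              17536 * (n : ℚ) + 3072) * balaSum (n - 1) +
          8 * (2 * (n : ℚ) - 3) * (4 * (n : ℚ) - 7) * (4 * (n : ℚ) - 5) *
            (51 * (n : ℚ) ^ 2 - 60 * (n : ℚ) + 16) * balaSum (n - 2) := by
  intro n hn _
  obtain rfl | rfl | ⟨m, rfl⟩ : n = 3 ∨ n = 4 ∨ ∃ m, n = m + 5 := by
    obtain h | h | h : n = 3 ∨ n = 4 ∨ 5 ≤ n := by omega
    · exact Or.inl h
    · exact Or.inr (Or.inl h)
    · exact Or.inr (Or.inr ⟨n - 5, by omega⟩)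
  · norm_num [balaSum, Finset.sum_range_succ, Nat.choose]
  · norm_num [balaSum, Finset.sum_range_succ, Nat.choose]
  · exact balaSum_recurrence m _ (by push_cast; rfl)
end
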